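/- arXiv:2409.14468 — 3 statements merged into one kernel-verified Lean document; each statement's English description precedes it below -/
import Mathlib

section
/- Let a > 0 and for each n ≥ 1 set q_n := 1 − a·2^{−n} (assume n large enough that q_n ∈ [0,1]). Then Σ_{k=1}^{n−1} q_n^{2^k}/2^k = 1 − a·n·2^{−n} + O(2^{−n}) as n → ∞; that is, there exist C > 0 and n₀ such that |Σ_{k=1}^{n−1} q_n^{2^k}/2^k − 1 + a·n·2^{−n}| ≤ C·2^{−n} for all n ≥ n₀. -/
/-- Second-order companion of Bernoulli's inequality. -/
theorem one_sub_pow_le_one_sub_mul_add_sq {x : ℝ} (h₀ : 0 ≤ x) (h₁ : x ≤ 1) (N : ℕ) :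
    (1 - x) ^ N ≤ 1 - N * x + (N * x) ^ 2 := by
  induction N with
  | zero => simp
  | succ N ih =>
    have hmul := mul_le_mul_of_nonneg_right ih (sub_nonneg.2 h₁)
    have h₂ : 0 ≤ (N : ℝ) * x ^ 2 := by positivity
    have h₃ : 0 ≤ (N : ℝ) ^ 2 * x ^ 3 := by positivity
    rw [pow_succ]
    push_cast
    nlinarith [sq_nonneg x]

theorem sum_one_sub_pow_two_pow_div_bounds {x : ℝ} (h₀ : 0 ≤ x) (h₁ : x ≤ 1) (m : ℕ) :
    1 - 1 / 2 ^ m - m * x ≤ ∑ k ∈ Finset.Icc 1 m, (1 - x) ^ (2 ^ k) / (2 : ℝ) ^ k ∧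
      ∑ k ∈ Finset.Icc 1 m, (1 - x) ^ (2 ^ k) / (2 : ℝ) ^ k ≤
        1 - 1 / 2 ^ m - m * x + 2 ^ (m + 1) * x ^ 2 := by
  induction m with
  | zero => simp [sq_nonneg]
  | succ m ih =>
    rw [Finset.sum_Icc_succ_top (by omega)]
    have hpos : (0 : ℝ) < 2 ^ (m + 1) := by positivity
    have hlow : 1 / 2 ^ (m + 1) - x ≤ (1 - x) ^ (2 ^ (m + 1)) / (2 : ℝ) ^ (m + 1) := by
      have h := one_add_mul_le_pow (a := -x) (by linarith) (2 ^ (m + 1))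
      rw [← sub_eq_add_neg] at h
      push_cast at h
      rw [le_div_iff₀ hpos, sub_mul, one_div_mul_cancel hpos.ne']
      linarith
    have hupp : (1 - x) ^ (2 ^ (m + 1)) / (2 : ℝ) ^ (m + 1) ≤
        1 / 2 ^ (m + 1) - x + 2 ^ (m + 1) * x ^ 2 := by
      have h := one_sub_pow_le_one_sub_mul_add_sq h₀ h₁ (2 ^ (m + 1))
      push_cast at h
      rw [div_le_iff₀ hpos, add_mul, sub_mul, one_div_mul_cancel hpos.ne']
      linarith
    have hhalf : (1 : ℝ) / 2 ^ m = 2 * (1 / 2 ^ (m + 1)) := by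
      field_simp
      ring
    have hdouble : (2 : ℝ) ^ (m + 1 + 1) * x ^ 2 = 2 * (2 ^ (m + 1) * x ^ 2) := by ring
    push_cast
    constructor <;> linarith [ih.1, ih.2]

/-- With `q_n = 1 - a * 2^{-n}`, one has
`∑_{k=1}^{n-1} q_n^{2^k}/2^k = 1 - a*n*2^{-n} + O(2^{-n})` as `n → ∞`. -/
theorem sum_q_pow_asymptotics (a : ℝ) (ha : 0 < a) :
    ∃ C > 0, ∃ n₀ : ℕ, ∀ n ≥ n₀,
      |(∑ k ∈ Finset.Icc 1 (n - 1), (1 - a / 2 ^ n) ^ (2 ^ k) / (2 : ℝ) ^ k)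
          - 1 + a * n / 2 ^ n| ≤ C / 2 ^ n := by
  obtain ⟨n₀, hn₀⟩ := pow_unbounded_of_one_lt a (one_lt_two (α := ℝ))
  refine ⟨a + 2 + a ^ 2, by positivity, n₀ + 1, fun n hn => ?_⟩
  obtain ⟨m, rfl⟩ : ∃ m, n = m + 1 := ⟨n - 1, by omega⟩
  have hpos : (0 : ℝ) < 2 ^ (m + 1) := by positivity
  have hle : a / 2 ^ (m + 1) ≤ 1 := by
    rw [div_le_one hpos]
    exact hn₀.le.trans (pow_le_pow_right₀ one_le_two (by omega))
  obtain ⟨hlow, hupp⟩ := sum_one_sub_pow_two_pow_div_bounds (by positivity) hle m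
  have hx : 0 < a / 2 ^ (m + 1) := by positivity
  have hy : 0 < (1 : ℝ) / 2 ^ (m + 1) := by positivity
  have hz : 0 < a ^ 2 / 2 ^ (m + 1) := by positivity
  have hsq : (2 : ℝ) ^ (m + 1) * (a / 2 ^ (m + 1)) ^ 2 = a ^ 2 / 2 ^ (m + 1) := by
    field_simp
  have hhalf : (1 : ℝ) / 2 ^ m = 2 * (1 / 2 ^ (m + 1)) := by
    field_simp
    ring
  have hC : (a + 2 + a ^ 2) / 2 ^ (m + 1) =
      a / 2 ^ (m + 1) + 2 * (1 / 2 ^ (m + 1)) + a ^ 2 / 2 ^ (m + 1) := by ring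
  have hmain : a * ((m + 1 : ℕ) : ℝ) / 2 ^ (m + 1) =
      m * (a / 2 ^ (m + 1)) + a / 2 ^ (m + 1) := by
    push_cast
    ring
  rw [hsq, hhalf] at hupp
  rw [hhalf] at hlow
  rw [Nat.add_sub_cancel, hmain, hC, abs_le]
  constructor <;> linarith
end

section
/- Let a > 0, β > 1, and let (p_N) be a sequence in [0,1] with N^β·p_N → a as N → ∞ (i.e., p_N ~ a/N^β). Then E[T(N)] = 1 + O((ln N)/N^{β−1}) as N → ∞; in particular E[T(N) − 1] → 0, so T(N) converges to the constant 1 in the L¹ sense, where T(N) = T(N; 1 − p_N). -/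
/-- Binary search test count. -/
def T : (n : ℕ) → (Fin n → Bool) → ℕ
  | 0, _ => 1
  | 1, _ => 1
  | n + 2, v =>
    if ∀ i, v i = false then 1
    else
      1 + T ((n + 2) / 2) (fun i => v ⟨i.1, by have := i.2; omega⟩)
        + T (n + 2 - (n + 2) / 2) (fun i => v ⟨(n + 2) / 2 + i.1, by have := i.2; omega⟩)
termination_by n _ => n
decreasing_by all_goals omega

/-- Expectation of f under the i.i.d. Bernoulli(p) product measure on {0,1}^n. -/
noncomputable def expect (n : ℕ) (p : ℝ) (f : (Fin n → Bool) → ℝ) : ℝ :=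
  ∑ v : Fin n → Bool, (∏ i, if v i then p else 1 - p) * f v

noncomputable def ET (n : ℕ) (p : ℝ) : ℝ := expect n p fun v => (T n v : ℝ)

noncomputable def varT (n : ℕ) (p : ℝ) : ℝ :=
  expect n p fun v => ((T n v : ℝ) - ET n p) ^ 2

open Classical in
/-- Probability of the event A under the i.i.d. Bernoulli(p) product measure. -/
noncomputable def prob (n : ℕ) (p : ℝ) (A : (Fin n → Bool) → Prop) : ℝ :=
  ∑ v : Fin n → Bool, if A v then (∏ i, if v i then p else 1 - p) else 0

theorem Fin.sum_univ_split {M : Type*} [AddCommMonoid M] {N m r : ℕ} (h : m + r = N)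
    (f : Fin N → M) :
    ∑ i, f i = ∑ i : Fin m, f ⟨i.1, by omega⟩ + ∑ i : Fin r, f ⟨m + i.1, by omega⟩ := by
  subst h
  exact Fin.sum_univ_add f

theorem one_le_T (n : ℕ) (v : Fin n → Bool) : 1 ≤ T n v := by
  match n, v with
  | 0, _ => simp [T]
  | 1, _ => simp [T]
  | n + 2, v =>
    rw [T]
    split_ifs <;> omega

/-- A positive entry is detected along a branch of depth at most `L`, and each node of that branch
costs at most two additional tests. -/
theorem T_le_of_le_two_pow (L n : ℕ) (hn : n ≤ 2 ^ L) (v : Fin n → Bool) :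
    T n v ≤ 1 + 2 * L * ∑ i, (if v i then 1 else 0) := by
  induction L generalizing n with
  | zero =>
    match n, v with
    | 0, _ => simp [T]
    | 1, _ => simp [T]
    | n + 2, _ => simp at hn
  | succ L ih =>
    match n, v with
    | 0, _ => simp [T]
    | 1, _ => simp [T]
    | n + 2, v =>
      rw [T]
      split_ifs with h
      · omega
      · push Not at h
        obtain ⟨i, hi⟩ := h
        have hpos : 1 ≤ ∑ i, (if v i then 1 else 0) := by
          refine le_trans ?_ (Finset.single_le_sum (f := fun i => if v i then 1 else 0)
            (fun _ _ => Nat.zero_le _) (Finset.mem_univ i))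
          simp [hi]
        rw [pow_succ] at hn
        have h₁ := ih ((n + 2) / 2) (by omega) (fun i => v ⟨i.1, by have := i.2; omega⟩)
        have h₂ := ih (n + 2 - (n + 2) / 2) (by omega)
          (fun i => v ⟨(n + 2) / 2 + i.1, by have := i.2; omega⟩)
        have hs := Fin.sum_univ_split (show (n + 2) / 2 + (n + 2 - (n + 2) / 2) = n + 2 by omega)
          (fun i => if v i then 1 else 0)
        rw [hs] at hpos ⊢
        nlinarith

theorem expect_mono {n : ℕ} {p : ℝ} (hp : p ∈ Set.Icc (0 : ℝ) 1) {f g : (Fin n → Bool) → ℝ}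
    (h : ∀ v, f v ≤ g v) : expect n p f ≤ expect n p g := by
  refine Finset.sum_le_sum fun v _ => mul_le_mul_of_nonneg_left (h v) ?_
  refine Finset.prod_nonneg fun i _ => ?_
  split_ifs
  · exact hp.1
  · exact sub_nonneg.2 hp.2

theorem expect_prod (n : ℕ) (p : ℝ) (f : Fin n → Bool → ℝ) :
    expect n p (fun v => ∏ i, f i (v i)) = ∏ i, (p * f i true + (1 - p) * f i false) := by
  have h := Finset.prod_univ_sum (fun _ : Fin n => (Finset.univ : Finset Bool))
    (fun i b => (if b then p else 1 - p) * f i b)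
  simp only [Fintype.piFinset_univ, Fintype.sum_bool, Finset.prod_mul_distrib] at h
  simpa [expect] using h.symm

theorem expect_one (n : ℕ) (p : ℝ) : expect n p (fun _ => 1) = 1 := by
  simpa using expect_prod n p (fun _ _ => 1)

theorem expect_apply (n : ℕ) (p : ℝ) (i : Fin n) :
    expect n p (fun v => if v i then 1 else 0) = p := by
  have h := expect_prod n p (fun j b => if j = i then (if b then 1 else 0) else 1)
  simp only [Finset.prod_ite_eq', Finset.mem_univ, if_true] at h
  rw [h, Finset.prod_eq_single i] <;> simp +contextual

theorem expect_affine_card (n : ℕ) (p c : ℝ) :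
    expect n p (fun v => 1 + c * ∑ i, (if v i then 1 else 0)) = 1 + c * (n * p) := by
  have h : ∑ i : Fin n, expect n p (fun v => if v i then 1 else 0) = n * p := by
    simp [expect_apply]
  have h₁ := expect_one n p
  rw [← h]
  simp only [expect, Finset.mul_sum, mul_add, Finset.sum_add_distrib] at h₁ ⊢
  rw [h₁, Finset.sum_comm]
  congr 1
  exact Finset.sum_congr rfl fun _ _ => Finset.sum_congr rfl fun _ _ => by ring

theorem one_le_ET {n : ℕ} {p : ℝ} (hp : p ∈ Set.Icc (0 : ℝ) 1) : 1 ≤ ET n p := by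
  rw [← expect_one n p]
  exact expect_mono hp fun v => by exact_mod_cast one_le_T n v

theorem ET_le {n : ℕ} (hn : 2 ≤ n) {p : ℝ} (hp : p ∈ Set.Icc (0 : ℝ) 1) :
    ET n p ≤ 1 + 8 * Real.log n * (n * p) := by
  have h₁ : ET n p ≤ 1 + 2 * ((Nat.log 2 n + 1 : ℕ) : ℝ) * (n * p) := by
    rw [← expect_affine_card]
    refine expect_mono hp fun v => ?_
    exact_mod_cast T_le_of_le_two_pow _ n (Nat.lt_pow_succ_log_self one_lt_two n).le v
  have h₂ : (1 : ℝ) ≤ Nat.log 2 n := by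
    exact_mod_cast Nat.log_pos one_lt_two hn
  have h₃ : (Nat.log 2 n : ℝ) ≤ 2 * Real.log n := by
    have h := Real.natLog_le_logb n 2
    rw [Real.logb, le_div_iff₀ (Real.log_pos (by norm_num))] at h
    have := Real.log_two_gt_d9
    push_cast at h
    nlinarith
  have h₄ : 0 ≤ (n : ℝ) * p := mul_nonneg n.cast_nonneg hp.1
  push_cast at h₁
  nlinarith

/-- Proposition 2: if `N^β * p_N → a > 0` with `β > 1`, then
`E[T(N)] = 1 + O((ln N)/N^{β-1})`; in particular `E[T(N) - 1] → 0`,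
i.e. `T(N) → 1` in `L¹`. -/
theorem expectation_beta_gt_one (a β : ℝ) (ha : 0 < a) (hβ : 1 < β) (p : ℕ → ℝ)
    (hp : ∀ N, p N ∈ Set.Icc (0 : ℝ) 1)
    (hlim : Filter.Tendsto (fun N : ℕ => (N : ℝ) ^ β * p N) Filter.atTop (nhds a)) :
    (∃ C > 0, ∃ N₀ : ℕ, ∀ N ≥ N₀,
        |ET N (p N) - 1| ≤ C * Real.log N / (N : ℝ) ^ (β - 1)) ∧
    Filter.Tendsto (fun N : ℕ => ET N (p N) - 1) Filter.atTop (nhds 0) := by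
  have hbound : ∀ᶠ N : ℕ in Filter.atTop,
      |ET N (p N) - 1| ≤ 8 * (a + 1) * Real.log N / (N : ℝ) ^ (β - 1) := by
    filter_upwards [hlim.eventually_le_const (lt_add_one a), Filter.eventually_ge_atTop 2]
      with N hN hN2
    have hpos : (0 : ℝ) < N := by positivity
    have hlog : 0 ≤ Real.log N := Real.log_natCast_nonneg N
    rw [abs_of_nonneg (sub_nonneg.2 (one_le_ET (hp N)))]
    have hNp : N * p N ≤ (a + 1) / (N : ℝ) ^ (β - 1) := by
      rw [le_div_iff₀ (by positivity)]
      calc N * p N * (N : ℝ) ^ (β - 1) = (N : ℝ) ^ β * p N := by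
            rw [Real.rpow_sub_one hpos.ne']
            field_simp
        _ ≤ a + 1 := hN
    calc ET N (p N) - 1 ≤ 8 * Real.log N * (N * p N) := by linarith [ET_le hN2 (hp N)]
      _ ≤ 8 * Real.log N * ((a + 1) / (N : ℝ) ^ (β - 1)) := by gcongr
      _ = 8 * (a + 1) * Real.log N / (N : ℝ) ^ (β - 1) := by ring
  refine ⟨⟨8 * (a + 1), by positivity, Filter.eventually_atTop.1 hbound⟩, ?_⟩
  refine squeeze_zero_norm' hbound ?_
  have h := ((isLittleO_log_rpow_atTop (sub_pos.2 hβ)).tendsto_div_nhds_zero.comp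
    tendsto_natCast_atTop_atTop).const_mul (8 * (a + 1))
  simpa [Function.comp_def, mul_div_assoc] using h
end

section
/- Let a > 0, β > 1, and let (p_N) be a sequence in [0,1] with N^β·p_N → a as N → ∞ (i.e., p_N ~ a/N^β). Then P{T(N) − 1 > 1/ln N} = O((ln N)²/N^{β−1}) as N → ∞, where T(N) = T(N; 1 − p_N). -/
theorem T_eq_one_of_forall_eq_false (n : ℕ) (v : Fin n → Bool) (h : ∀ i, v i = false) :
    T n v = 1 := by
  match n, v, h with
  | 0, _, _ => simp [T]
  | 1, _, _ => simp [T]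
  | n + 2, v, h => rw [T, if_pos h]

theorem sum_prod_bernoulli (n : ℕ) (p : ℝ) :
    ∑ v : Fin n → Bool, ∏ i, (if v i then p else 1 - p) = 1 := by
  rw [← Fintype.prod_sum (fun (_ : Fin n) (b : Bool) => if b then p else 1 - p)]
  simp

/-- Union bound: an event not containing the all-zero vector has probability at most `n * p`. -/
theorem prob_le_mul_of_not_zero (n : ℕ) (p : ℝ) (hp : p ∈ Set.Icc (0 : ℝ) 1)
    (A : (Fin n → Bool) → Prop) (hA : ¬ A fun _ => false) : prob n p A ≤ n * p := by
  classical
  have hw (v : Fin n → Bool) : 0 ≤ ∏ i, (if v i then p else 1 - p) :=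
    Finset.prod_nonneg fun i _ => by split_ifs <;> linarith [hp.1, hp.2]
  have hsum := sum_prod_bernoulli n p
  rw [← Finset.add_sum_erase _ _ (Finset.mem_univ fun _ : Fin n => false)] at hsum
  have hprob : prob n p A ≤
      ∑ v ∈ Finset.univ.erase (fun _ : Fin n => false), ∏ i, (if v i then p else 1 - p) := by
    rw [prob, ← Finset.add_sum_erase _ _ (Finset.mem_univ fun _ : Fin n => false), if_neg hA,
      zero_add]
    refine Finset.sum_le_sum fun v _ => ?_
    split_ifs
    exacts [le_rfl, hw v]
  have hpow : 1 + (n : ℝ) * -p ≤ (1 + -p) ^ n := one_add_mul_le_pow (by linarith [hp.2]) n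
  simp only [Bool.false_eq_true, if_false, Finset.prod_const, Finset.card_univ,
    Fintype.card_fin] at hsum
  rw [← sub_eq_add_neg] at hpow
  linarith

/-- Remark 1 (first part): if `N^β * p_N → a > 0` with `β > 1`, then
`P{T(N) - 1 > 1/ln N} = O((ln N)²/N^{β-1})` as `N → ∞`. -/
theorem prob_tail_bigO (a β : ℝ) (ha : 0 < a) (hβ : 1 < β) (p : ℕ → ℝ)
    (hp : ∀ N, p N ∈ Set.Icc (0 : ℝ) 1)
    (hlim : Filter.Tendsto (fun N : ℕ => (N : ℝ) ^ β * p N) Filter.atTop (nhds a)) :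
    ∃ C > 0, ∃ N₀ : ℕ, ∀ N ≥ N₀,
      prob N (p N) (fun v => (T N v : ℝ) - 1 > 1 / Real.log N)
        ≤ C * (Real.log N) ^ 2 / (N : ℝ) ^ (β - 1) := by
  obtain ⟨N₁, hN₁⟩ := Filter.eventually_atTop.1 (hlim.eventually_lt_const (lt_add_one a))
  refine ⟨a + 1, by linarith, max N₁ 3, fun N hN => ?_⟩
  have hN3 : (3 : ℝ) ≤ N := by exact_mod_cast (le_max_right _ _).trans hN
  have hN0 : (0 : ℝ) < N := by linarith
  have hlog : 1 ≤ Real.log N :=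
    (Real.le_log_iff_exp_le hN0).2 (Real.exp_one_lt_three.le.trans hN3)
  have hpN := hN₁ N ((le_max_left _ _).trans hN)
  refine (prob_le_mul_of_not_zero N (p N) (hp N) _ ?_).trans ?_
  · rw [T_eq_one_of_forall_eq_false N _ fun _ => rfl]
    simpa using zero_le_one.trans hlog
  · rw [le_div_iff₀ (Real.rpow_pos_of_pos hN0 _)]
    calc (N : ℝ) * p N * (N : ℝ) ^ (β - 1) = (N : ℝ) ^ β * p N := by
          rw [Real.rpow_sub_one hN0.ne']
          field_simp
      _ ≤ (a + 1) * 1 := by linarith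
      _ ≤ (a + 1) * Real.log N ^ 2 := by
          gcongr
          exact one_le_pow₀ hlog
end
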